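/- arXiv:1705.00999 — 2 statements merged into one kernel-verified Lean document; each statement's English description precedes it below -/
import Mathlib

section
/- Under the hypotheses of the shift functional with v₊ > v₋, β > 0, and the additional decay bound |U(ξ)| ≤ C₁δ e^{c₁ξ} for all ξ ≤ 0 (where δ, C₁ > 0), the unique shift α with I(α) = 0 satisfies |α| ≤ (v₊ − v₋)⁻¹ ( ∫₀^∞ |v₀(x) − V(x − β)| dx + (C₁δ/(c₁ s)) e^{−c₁β} ). In particular, α → 0 as ‖v₀ − V(· − β)‖_{L¹(0,∞)} → 0 and β → ∞. -/
open MeasureTheory Filter Set Real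

/-- A function bounded by a decaying exponential on the negative half-line has a small integral
along the ray `t ↦ -(s * t) - β`. -/
theorem abs_integral_comp_ray_le {s c K β : ℝ} (hs : 0 < s) (hc : 0 < c) (hβ : 0 ≤ β)
    {U : ℝ → ℝ} (hU : ∀ ξ ≤ (0 : ℝ), |U ξ| ≤ K * Real.exp (c * ξ)) :
    |∫ t in Ioi (0 : ℝ), U (-(s * t) - β)| ≤ K / (c * s) * Real.exp (-(c * β)) := by
  have hneg : -(c * s) < 0 := neg_neg_of_pos (mul_pos hc hs)
  have hbound : ∀ t ∈ Ioi (0 : ℝ),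
      ‖U (-(s * t) - β)‖ ≤ K * Real.exp (-(c * β)) * Real.exp (-(c * s) * t) := by
    intro t ht
    refine (hU _ (by linarith [mul_pos hs (mem_Ioi.mp ht)])).trans_eq ?_
    rw [mul_assoc, ← Real.exp_add]
    ring_nf
  calc |∫ t in Ioi (0 : ℝ), U (-(s * t) - β)|
      ≤ ∫ t in Ioi (0 : ℝ), K * Real.exp (-(c * β)) * Real.exp (-(c * s) * t) :=
        norm_integral_le_of_norm_le ((integrableOn_exp_mul_Ioi hneg 0).const_mul _)
          (ae_restrict_of_forall_mem measurableSet_Ioi hbound)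
    _ = K / (c * s) * Real.exp (-(c * β)) := by
        rw [integral_const_mul, integral_exp_mul_Ioi hneg 0, mul_zero, Real.exp_zero]
        field_simp

/-- Quantitative bound on the shift `α` (the unique zero of the
excess mass functional, given by its explicit formula):
`|α| ≤ (v₊ − v₋)⁻¹ ( ‖v₀ − V(·−β)‖_{L¹(0,∞)} + (C₁δ/(c₁ s)) e^{−c₁β} )`;
in particular `α → 0` as the initial `L¹` perturbation tends to `0` and `β → ∞`. -/
theorem shift_smallness_bound
    (s c₁ C C₁ δ vm vp β : ℝ) (hs : 0 < s) (hc₁ : 0 < c₁) (hC : 0 < C)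
    (hC₁ : 0 < C₁) (hδ : 0 < δ)
    (hvm : 0 < vm) (hvp : 0 < vp) (hord : vm < vp) (hβ : 0 < β)
    (V U : ℝ → ℝ) (hV : ContDiff ℝ 1 V) (hU : ContDiff ℝ 1 U)
    (hmass : ∀ ξ : ℝ, s * V ξ + U ξ = s * vm)
    (hVlim : Tendsto V atTop (nhds vp))
    (hUlim : Tendsto U atBot (nhds 0))
    (hderiv : ∀ ξ : ℝ, |deriv V ξ| + |deriv U ξ| ≤ C * Real.exp (-(c₁ * |ξ|)))
    (hUdec : ∀ ξ ≤ (0:ℝ), |U ξ| ≤ C₁ * δ * Real.exp (c₁ * ξ))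
    (v₀ : ℝ → ℝ)
    (hint : IntegrableOn (fun x => v₀ x - V (x - β)) (Ioi 0)) :
    |(vp - vm)⁻¹ * ((∫ x in Ioi (0:ℝ), (v₀ x - V (x - β)))
        + ∫ t in Ioi (0:ℝ), U (-(s * t) - β))|
      ≤ (vp - vm)⁻¹ * ((∫ x in Ioi (0:ℝ), |v₀ x - V (x - β)|)
        + (C₁ * δ / (c₁ * s)) * Real.exp (-(c₁ * β))) := by
  have hinv : 0 ≤ (vp - vm)⁻¹ := inv_nonneg.mpr (sub_nonneg.mpr hord.le)
  rw [abs_mul, abs_of_nonneg hinv]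
  refine mul_le_mul_of_nonneg_left ((abs_add_le _ _).trans (add_le_add ?_ ?_)) hinv
  · exact abs_integral_le_integral_abs
  · exact abs_integral_comp_ray_le hs hc₁ hβ.le hUdec
end

section
/- Under the stated hypotheses, there exist positive constants δ₀, ε₀ and C, depending only on p, μ, κ, s, c₁, C₁, v₋, v₊ and independent of α, β and T, such that if δ ≤ δ₀ and ε ≤ ε₀ then for all t ∈ [0, T]: |∫₀^t (φψ)(0,τ) dτ| + |∫₀^t (ψψ_x)(0,τ) dτ| + |∫₀^t (ψ_x φ_x)(0,τ) dτ| + |∫₀^t (ψ_t ψ_x)(0,τ) dτ| + |∫₀^t (ψ_x ψ_xx)(0,τ) dτ| + |∫₀^t (ψ_{xt} ψ_xx)(0,τ) dτ| ≤ C e^{−c₁β}. -/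
open MeasureTheory Filter Set Real

/-- Spatial partial derivative `∂f/∂x` of a function `f(x,t)`. -/
noncomputable def pdx (f : ℝ → ℝ → ℝ) : ℝ → ℝ → ℝ := fun x t => deriv (fun y => f y t) x

/-- Temporal partial derivative `∂f/∂t` of a function `f(x,t)`. -/
noncomputable def pdt (f : ℝ → ℝ → ℝ) : ℝ → ℝ → ℝ := fun x t => deriv (fun r => f x r) t

/-- `‖f(·,t)‖²`, the squared `L²(0,∞)` norm in `x` at time `t`. -/
noncomputable def sqnorm (f : ℝ → ℝ → ℝ) (t : ℝ) : ℝ := ∫ x in Set.Ioi (0:ℝ), (f x t) ^ 2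

/-- `‖f(·,t)‖ₖ²`, the squared `Hᵏ(0,∞)` Sobolev norm in `x` at time `t`. -/
noncomputable def Hsq (k : ℕ) (f : ℝ → ℝ → ℝ) (t : ℝ) : ℝ :=
  ∑ j ∈ Finset.range (k + 1), sqnorm (pdx^[j] f) t

/-- The nonlinear source term `F` of the reformulated Navier–Stokes–Korteweg system,
where the shock profile `(V, U)` is evaluated at `ξ = x − st + α − β` and
`v = V + φ_x`. -/
noncomputable def NSKF (p : ℝ → ℝ) (μ κ s α β : ℝ) (V U : ℝ → ℝ)
    (φ ψ : ℝ → ℝ → ℝ) (x t : ℝ) : ℝ :=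
  -(p (V (x - s*t + α - β) + pdx φ x t) - p (V (x - s*t + α - β))
      - deriv p (V (x - s*t + α - β)) * pdx φ x t)
  - μ * pdx (pdx ψ) x t * pdx φ x t
      / ((V (x - s*t + α - β) + pdx φ x t) * V (x - s*t + α - β))
  + κ * deriv (deriv V) (x - s*t + α - β)
      * (1 / (V (x - s*t + α - β)) ^ 5 - 1 / (V (x - s*t + α - β) + pdx φ x t) ^ 5)
  + (5 * κ / 2) * ((pdx (pdx φ) x t) ^ 2 + 2 * pdx (pdx φ) x t * deriv V (x - s*t + α - β))
      / (V (x - s*t + α - β) + pdx φ x t) ^ 6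
  + (5 * κ / 2) * (deriv V (x - s*t + α - β)) ^ 2
      * (1 / (V (x - s*t + α - β)) ^ 6 - 1 / (V (x - s*t + α - β) + pdx φ x t) ^ 6)
  + μ * deriv U (x - s*t + α - β) * (pdx φ x t) ^ 2
      / ((V (x - s*t + α - β) + pdx φ x t) * (V (x - s*t + α - β)) ^ 2)

section PartialDerivatives

variable {f : ℝ → ℝ → ℝ}

theorem hasDerivAt_pdx (hf : ContDiff ℝ (⊤ : ℕ∞) (Function.uncurry f)) (x t : ℝ) :
    HasDerivAt (fun y => f y t) (fderiv ℝ (Function.uncurry f) (x, t) (1, 0)) x := by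
  have h1 : HasFDerivAt (Function.uncurry f) (fderiv ℝ (Function.uncurry f) (x, t)) (x, t) :=
    (hf.differentiable (by simp)).differentiableAt.hasFDerivAt
  exact h1.comp_hasDerivAt x ((hasDerivAt_id x).prodMk (hasDerivAt_const x t))

theorem hasDerivAt_pdt (hf : ContDiff ℝ (⊤ : ℕ∞) (Function.uncurry f)) (x t : ℝ) :
    HasDerivAt (fun r => f x r) (fderiv ℝ (Function.uncurry f) (x, t) (0, 1)) t := by
  have h1 : HasFDerivAt (Function.uncurry f) (fderiv ℝ (Function.uncurry f) (x, t)) (x, t) :=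
    (hf.differentiable (by simp)).differentiableAt.hasFDerivAt
  exact h1.comp_hasDerivAt t ((hasDerivAt_const t x).prodMk (hasDerivAt_id t))

theorem uncurry_pdx_eq (hf : ContDiff ℝ (⊤ : ℕ∞) (Function.uncurry f)) :
    Function.uncurry (pdx f) = fun z => fderiv ℝ (Function.uncurry f) z (1, 0) := by
  ext ⟨x, t⟩
  exact (hasDerivAt_pdx hf x t).deriv

theorem uncurry_pdt_eq (hf : ContDiff ℝ (⊤ : ℕ∞) (Function.uncurry f)) :
    Function.uncurry (pdt f) = fun z => fderiv ℝ (Function.uncurry f) z (0, 1) := by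
  ext ⟨x, t⟩
  exact (hasDerivAt_pdt hf x t).deriv

theorem contDiff_pdx (hf : ContDiff ℝ (⊤ : ℕ∞) (Function.uncurry f)) :
    ContDiff ℝ (⊤ : ℕ∞) (Function.uncurry (pdx f)) := by
  rw [uncurry_pdx_eq hf]
  exact (hf.fderiv_right (m := (⊤ : ℕ∞)) (by simp)).clm_apply contDiff_const

theorem contDiff_pdt (hf : ContDiff ℝ (⊤ : ℕ∞) (Function.uncurry f)) :
    ContDiff ℝ (⊤ : ℕ∞) (Function.uncurry (pdt f)) := by
  rw [uncurry_pdt_eq hf]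
  exact (hf.fderiv_right (m := (⊤ : ℕ∞)) (by simp)).clm_apply contDiff_const

theorem pdx_pdt_comm (hf : ContDiff ℝ (⊤ : ℕ∞) (Function.uncurry f)) (x t : ℝ) :
    pdx (pdt f) x t = pdt (pdx f) x t := by
  have hd : DifferentiableAt ℝ (fderiv ℝ (Function.uncurry f)) (x, t) :=
    ((hf.fderiv_right (m := (⊤ : ℕ∞)) (by simp)).differentiable (by simp)).differentiableAt
  have hsymm : IsSymmSndFDerivAt ℝ (Function.uncurry f) (x, t) :=
    hf.contDiffAt.isSymmSndFDerivAt
      (by simpa using WithTop.coe_le_coe.2 (le_top : (2 : ℕ∞) ≤ ⊤))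
  have h1 : pdx (pdt f) x t = fderiv ℝ (Function.uncurry (pdt f)) (x, t) (1, 0) :=
    (hasDerivAt_pdx (contDiff_pdt hf) x t).deriv
  have h2 : pdt (pdx f) x t = fderiv ℝ (Function.uncurry (pdx f)) (x, t) (0, 1) :=
    (hasDerivAt_pdt (contDiff_pdx hf) x t).deriv
  rw [h1, h2, uncurry_pdt_eq hf, uncurry_pdx_eq hf,
    fderiv_clm_apply hd (differentiableAt_const _), fderiv_clm_apply hd (differentiableAt_const _)]
  simpa using hsymm.eq (1, 0) (0, 1)

theorem hasDerivAt_time (hf : ContDiff ℝ (⊤ : ℕ∞) (Function.uncurry f)) (x t : ℝ) :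
    HasDerivAt (f x) (pdt f x t) t :=
  (hasDerivAt_pdt hf x t).differentiableAt.hasDerivAt

theorem continuous_time (hf : ContDiff ℝ (⊤ : ℕ∞) (Function.uncurry f)) (x : ℝ) :
    Continuous (f x) :=
  hf.continuous.comp (Continuous.prodMk_right x)

/-- Differentiating `φ_t = ψ_x` in `x` up to the boundary `x = 0`. -/
theorem pdx_pdx_eq_pdt_pdx_at_zero {φ ψ : ℝ → ℝ → ℝ} {t : ℝ}
    (hφ : ContDiff ℝ (⊤ : ℕ∞) (Function.uncurry φ))
    (hψ : ContDiff ℝ (⊤ : ℕ∞) (Function.uncurry ψ))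
    (h : ∀ x ∈ Set.Ioi (0:ℝ), pdt φ x t - pdx ψ x t = 0) :
    pdx (pdx ψ) 0 t = pdt (pdx φ) 0 t := by
  have hpos : ∀ x ∈ Set.Ioi (0:ℝ), pdx (pdx ψ) x t = pdt (pdx φ) x t := by
    intro x hx
    rw [← pdx_pdt_comm hφ]
    refine Filter.EventuallyEq.deriv_eq ?_
    filter_upwards [Ioi_mem_nhds hx] with y hy
    linarith [h y hy]
  have c1 : Continuous (fun x => pdx (pdx ψ) x t) :=
    (contDiff_pdx (contDiff_pdx hψ)).continuous.comp (Continuous.prodMk_left t)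
  have c2 : Continuous (fun x => pdt (pdx φ) x t) :=
    (contDiff_pdt (contDiff_pdx hφ)).continuous.comp (Continuous.prodMk_left t)
  have hcl : Set.EqOn (fun x => pdx (pdx ψ) x t) (fun x => pdt (pdx φ) x t)
      (closure (Set.Ioi 0)) :=
    Set.EqOn.closure (fun x hx => hpos x hx) c1 c2
  exact hcl (by simp)

end PartialDerivatives

/-- The trace inequality `g(0)² ≤ ‖g‖² + ‖g'‖²` on the half-line. -/
theorem sq_trace_le {g g' : ℝ → ℝ} (hg : ∀ x, HasDerivAt g (g' x) x)
    (hg' : Continuous g') (hi : IntegrableOn (fun x => g x ^ 2) (Set.Ioi 0))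
    (hi' : IntegrableOn (fun x => g' x ^ 2) (Set.Ioi 0)) (h0 : Tendsto g atTop (nhds 0)) :
    g 0 ^ 2 ≤ (∫ x in Set.Ioi (0:ℝ), g x ^ 2) + ∫ x in Set.Ioi (0:ℝ), g' x ^ 2 := by
  have hgc : Continuous g := continuous_iff_continuousAt.2 fun x => (hg x).continuousAt
  have hd : ∀ x, HasDerivAt (fun y => g y ^ 2) (2 * g x * g' x) x := fun x => by
    simpa using (hg x).fun_pow 2
  have hint : IntegrableOn (fun x => 2 * g x * g' x) (Set.Ioi 0) := by
    refine (hi.add hi').mono' (by fun_prop) (ae_of_all _ fun x => ?_)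
    rw [Real.norm_eq_abs, abs_le]
    simp only [Pi.add_apply]
    constructor <;> nlinarith [sq_nonneg (g x + g' x), sq_nonneg (g x - g' x)]
  have hftc := integral_Ioi_of_hasDerivAt_of_tendsto' (fun x _ => hd x) hint
    (by simpa using h0.pow 2)
  rw [← integral_add hi hi']
  have hle : ∫ x in Set.Ioi (0:ℝ), -(2 * g x * g' x)
      ≤ ∫ x in Set.Ioi (0:ℝ), (g x ^ 2 + g' x ^ 2) :=
    integral_mono hint.neg (hi.add hi') fun x => by nlinarith [sq_nonneg (g x + g' x)]
  rw [integral_neg, hftc] at hle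
  linarith

theorem sqnorm_nonneg (f : ℝ → ℝ → ℝ) (t : ℝ) : 0 ≤ sqnorm f t :=
  integral_nonneg fun _ => sq_nonneg _

/-- The boundary value of `∂ₓʲf` is controlled by the `Hᵏ` norm for every `j < k`. -/
theorem abs_iterate_pdx_le_of_sqrt_Hsq_le {f : ℝ → ℝ → ℝ} {t ε : ℝ} {j k : ℕ} (hjk : j < k)
    (hf : ContDiff ℝ (⊤ : ℕ∞) (Function.uncurry (pdx^[j] f)))
    (hi : IntegrableOn (fun x => (pdx^[j] f x t) ^ 2) (Set.Ioi 0))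
    (hi' : IntegrableOn (fun x => (pdx^[j + 1] f x t) ^ 2) (Set.Ioi 0))
    (h0 : Tendsto (fun x => pdx^[j] f x t) atTop (nhds 0))
    (hε : √(Hsq k f t) ≤ ε) : |pdx^[j] f 0 t| ≤ ε := by
  rw [Function.iterate_succ_apply'] at hi'
  have h1 := sq_trace_le (g := fun x => pdx^[j] f x t) (g' := fun x => pdx (pdx^[j] f) x t)
    (fun x => (hasDerivAt_pdx hf x t).differentiableAt.hasDerivAt)
    ((contDiff_pdx hf).continuous.comp (Continuous.prodMk_left t)) hi hi' h0
  have h2 : sqnorm (pdx^[j] f) t + sqnorm (pdx (pdx^[j] f)) t ≤ Hsq k f t := by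
    rw [← Function.iterate_succ_apply' pdx, Hsq,
      ← Finset.sum_pair (f := fun i => sqnorm (pdx^[i] f) t) (Nat.lt_succ_self j).ne]
    refine Finset.sum_le_sum_of_subset_of_nonneg ?_ fun i _ _ => sqnorm_nonneg _ t
    intro i hi
    simp only [Finset.mem_insert, Finset.mem_singleton, Finset.mem_range] at hi ⊢
    omega
  exact (Real.abs_le_sqrt (h1.trans h2)).trans hε

theorem integral_Ioi_exp_neg_mul {a : ℝ} (ha : 0 < a) (c : ℝ) :
    ∫ τ in Set.Ioi c, Real.exp (-(a * τ)) = Real.exp (-(a * c)) / a := by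
  have h := integral_exp_mul_Ioi (a := -a) (by linarith) c
  simp only [neg_mul] at h
  rw [h, neg_div_neg_eq]

theorem integrableOn_Ioi_exp_neg_mul {a : ℝ} (ha : 0 < a) (c : ℝ) :
    IntegrableOn (fun τ => Real.exp (-(a * τ))) (Set.Ioi c) := by
  simpa only [neg_mul] using integrableOn_exp_mul_Ioi (a := -a) (by linarith) c

theorem abs_integral_Ici_le_of_exp_bound {f : ℝ → ℝ} {K a t : ℝ} (ha : 0 < a)
    (hf : ∀ τ ≥ t, |f τ| ≤ K * Real.exp (-(a * τ))) :
    |∫ τ in Set.Ici t, f τ| ≤ K / a * Real.exp (-(a * t)) := by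
  rw [integral_Ici_eq_integral_Ioi]
  have h := norm_integral_le_of_norm_le (f := f) ((integrableOn_Ioi_exp_neg_mul ha t).const_mul K)
    ((ae_restrict_iff' measurableSet_Ioi).2 (ae_of_all _ fun τ hτ => hf τ (le_of_lt hτ)))
  rw [integral_const_mul, integral_Ioi_exp_neg_mul ha] at h
  calc _ ≤ _ := h
    _ = _ := by ring

theorem abs_intervalIntegral_le_of_exp_bound {f : ℝ → ℝ} {K a t : ℝ} (ha : 0 < a) (hK : 0 ≤ K)
    (ht : 0 ≤ t) (hf : ∀ τ ∈ Set.Ioo 0 t, |f τ| ≤ K * Real.exp (-(a * τ))) :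
    |∫ τ in (0:ℝ)..t, f τ| ≤ K / a := by
  have hint := (integrableOn_Ioi_exp_neg_mul ha 0).const_mul K
  rw [intervalIntegral.integral_of_le ht, integral_Ioc_eq_integral_Ioo]
  have h := norm_integral_le_of_norm_le (f := f) (IntegrableOn.mono_set hint Set.Ioo_subset_Ioi_self)
    ((ae_restrict_iff' measurableSet_Ioo).2 (ae_of_all _ hf))
  refine h.trans ((setIntegral_mono_set hint (ae_of_all _ fun τ => by positivity)
    Set.Ioo_subset_Ioi_self.eventuallyLE).trans_eq ?_)
  rw [integral_const_mul, integral_Ioi_exp_neg_mul ha]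
  simp [div_eq_mul_inv]

/-- Bound for `∫ w u'` obtained by moving the derivative onto the exponentially decaying
factor `w`. -/
theorem abs_integral_mul_deriv_le_of_exp_bound {f u w u' w' : ℝ → ℝ} {K a t : ℝ} (ha : 0 < a)
    (hK : 0 ≤ K) (ht : 0 ≤ t)
    (hu : ∀ τ, HasDerivAt u (u' τ) τ) (hu' : Continuous u')
    (hw : ∀ τ, HasDerivAt w (w' τ) τ) (hw' : Continuous w')
    (hub : ∀ τ ∈ Set.Icc 0 t, |u τ| ≤ 1)
    (hwb : ∀ τ ≥ 0, |w τ| ≤ K * Real.exp (-(a * τ)))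
    (hwb' : ∀ τ ≥ 0, |w' τ| ≤ K * Real.exp (-(a * τ)))
    (hf : ∀ τ ∈ Set.Ioo 0 t, f τ = w τ * u' τ) :
    |∫ τ in (0:ℝ)..t, f τ| ≤ 2 * K + K / a := by
  have hcongr : ∫ τ in (0:ℝ)..t, f τ = ∫ τ in (0:ℝ)..t, w τ * u' τ := by
    rw [intervalIntegral.integral_of_le ht, intervalIntegral.integral_of_le ht,
      integral_Ioc_eq_integral_Ioo, integral_Ioc_eq_integral_Ioo]
    exact setIntegral_congr_fun measurableSet_Ioo hf
  rw [hcongr, intervalIntegral.integral_mul_deriv_eq_deriv_mul (fun τ _ => hw τ) (fun τ _ => hu τ)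
    (hw'.intervalIntegrable _ _) (hu'.intervalIntegrable _ _)]
  have hbd : ∀ τ ∈ Set.Icc 0 t, |w τ * u τ| ≤ K := fun τ hτ => by
    have hexp : Real.exp (-(a * τ)) ≤ 1 := by
      rw [Real.exp_le_one_iff]
      nlinarith [hτ.1]
    calc |w τ * u τ| = |w τ| * |u τ| := abs_mul _ _
      _ ≤ (K * 1) * 1 := mul_le_mul ((hwb τ hτ.1).trans (by gcongr)) (hub τ hτ) (abs_nonneg _)
          (by linarith)
      _ = K := by ring
  have hint : |∫ τ in (0:ℝ)..t, w' τ * u τ| ≤ K / a :=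
    abs_intervalIntegral_le_of_exp_bound ha hK ht fun τ hτ => by
      rw [abs_mul]
      exact (mul_le_of_le_one_right (abs_nonneg _) (hub τ ⟨hτ.1.le, hτ.2.le⟩)).trans
        (hwb' τ hτ.1.le)
  have h0 := hbd 0 ⟨le_rfl, ht⟩
  have h1 := hbd t ⟨ht, le_rfl⟩
  rw [abs_le] at *
  constructor <;> linarith [h0.1, h0.2, h1.1, h1.2, hint.1, hint.2]

theorem abs_integral_mul_le_of_exp_bound {f w u : ℝ → ℝ} {K a t : ℝ} (ha : 0 < a)
    (hK : 0 ≤ K) (ht : 0 ≤ t) (hub : ∀ τ ∈ Set.Icc 0 t, |u τ| ≤ 1)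
    (hwb : ∀ τ ≥ 0, |w τ| ≤ K * Real.exp (-(a * τ)))
    (hf : ∀ τ ∈ Set.Icc 0 t, f τ = w τ * u τ) :
    |∫ τ in (0:ℝ)..t, f τ| ≤ K / a :=
  abs_intervalIntegral_le_of_exp_bound ha hK ht fun τ hτ => by
    have hτ' := Set.Ioo_subset_Icc_self hτ
    rw [hf τ hτ', abs_mul]
    exact (mul_le_of_le_one_right (abs_nonneg _) (hub τ hτ')).trans (hwb τ hτ.1.le)

/-- The profile at the boundary `x = 0` decays in time, up to the factor `e^{-cβ}`. -/
theorem exp_neg_abs_shift_le {s c α β τ : ℝ} (hs : 0 < s) (hc : 0 < c) (hα : |α| < 1) (hβ : 1 < β)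
    (hτ : 0 ≤ τ) :
    -(s * τ) + α - β ≤ 0 ∧
      Real.exp (-(c * |-(s * τ) + α - β|))
        ≤ Real.exp c * Real.exp (-(c * β)) * Real.exp (-(c * s * τ)) := by
  have hα' := abs_lt.1 hα
  have hsτ : 0 ≤ s * τ := by positivity
  have hneg : -(s * τ) + α - β ≤ 0 := by linarith
  refine ⟨hneg, ?_⟩
  rw [abs_of_nonpos hneg, ← Real.exp_add, ← Real.exp_add, Real.exp_le_exp]
  nlinarith

/-- Boundary estimates (first group) for the half-line shock stability problem of the Navier–Stokes–Korteweg system: the boundary terms built from `φ, ψ` and their first derivatives are bounded by `C e^{−c₁β}`. -/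
theorem boundary_estimates_first
    (p : ℝ → ℝ) (μ κ s c₁ C₁ vm vp : ℝ)
    (hp : ContDiffOn ℝ (⊤ : ℕ∞) p (Set.Ioi 0))
    (hp1 : ∀ v > (0:ℝ), deriv p v < 0)
    (hp2 : ∀ v > (0:ℝ), deriv (deriv p) v > 0)
    (hμ : 0 < μ) (hκ : 0 < κ) (hs : 0 < s) (hc₁ : 0 < c₁) (hC₁ : 0 < C₁)
    (hvm : 0 < vm) (hvmvp : vm < vp) :
    ∃ δ₀ > 0, ∃ ε₀ > 0, ∃ C > 0,
      ∀ (up α β T ε : ℝ) (V U : ℝ → ℝ) (φ ψ : ℝ → ℝ → ℝ),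
        up < 0 → |α| < 1 → 1 < β → 0 < T → 0 < ε → ε < 1 →
        ContDiff ℝ (⊤ : ℕ∞) V → ContDiff ℝ (⊤ : ℕ∞) U →
        (∀ ξ : ℝ, s * V ξ + U ξ = s * vm) →
        (∀ ξ : ℝ, μ * deriv U ξ / V ξ - κ * deriv (deriv V) ξ / (V ξ) ^ 5
            + (5 * κ / 2) * (deriv V ξ) ^ 2 / (V ξ) ^ 6
          = -(s * U ξ) + p (V ξ) - p vm) →
        (∀ ξ : ℝ, 0 < deriv V ξ) → (∀ ξ : ℝ, deriv U ξ < 0) →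
        (∀ ξ ≤ (0:ℝ), |V ξ - vm| + |U ξ| ≤ C₁ * (vp - vm) * Real.exp (c₁ * ξ)) →
        (∀ ξ ≥ (0:ℝ), |V ξ - vp| + |U ξ - up| ≤ C₁ * (vp - vm) * Real.exp (-(c₁ * ξ))) →
        (∀ ξ : ℝ, |deriv V ξ| + |deriv U ξ|
          ≤ C₁ * (vp - vm) ^ 2 * Real.exp (-(c₁ * |ξ|))) →
        (∀ ξ : ℝ, |deriv (deriv V) ξ| + |deriv (deriv U) ξ|
          ≤ C₁ * (vp - vm) ^ 2 * Real.exp (-(c₁ * |ξ|))) →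
        (∀ ξ : ℝ, |deriv (deriv (deriv V)) ξ| + |deriv (deriv (deriv U)) ξ|
          ≤ C₁ * (vp - vm) ^ 2 * Real.exp (-(c₁ * |ξ|))) →
        ContDiff ℝ (⊤ : ℕ∞) (Function.uncurry φ) →
        ContDiff ℝ (⊤ : ℕ∞) (Function.uncurry ψ) →
        (∀ t ∈ Set.Icc (0:ℝ) T, ∀ j ≤ 4,
          IntegrableOn (fun x => (pdx^[j] φ x t) ^ 2) (Set.Ioi 0) ∧
          Tendsto (fun x => pdx^[j] φ x t) atTop (nhds 0)) →
        (∀ t ∈ Set.Icc (0:ℝ) T, ∀ j ≤ 3,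
          IntegrableOn (fun x => (pdx^[j] ψ x t) ^ 2) (Set.Ioi 0) ∧
          Tendsto (fun x => pdx^[j] ψ x t) atTop (nhds 0)) →
        (∀ x ≥ (0:ℝ), ∀ t ∈ Set.Icc (0:ℝ) T,
          vm / 2 ≤ V (x - s * t + α - β) + pdx φ x t ∧
          V (x - s * t + α - β) + pdx φ x t ≤ 3 / 2 * vp) →
        (∀ x ∈ Set.Ioi (0:ℝ), ∀ t ∈ Set.Ioo (0:ℝ) T, pdt φ x t - pdx ψ x t = 0) →
        (∀ x ∈ Set.Ioi (0:ℝ), ∀ t ∈ Set.Ioo (0:ℝ) T,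
          pdt ψ x t + deriv p (V (x - s * t + α - β)) * pdx φ x t
            - μ / V (x - s * t + α - β) * pdx (pdx ψ) x t
            + κ * pdx (pdx (pdx φ)) x t / (V (x - s * t + α - β) + pdx φ x t) ^ 5
            + μ * deriv U (x - s * t + α - β) * pdx φ x t / (V (x - s * t + α - β)) ^ 2
          = NSKF p μ κ s α β V U φ ψ x t) →
        (∀ t ∈ Set.Icc (0:ℝ) T, φ 0 t = ∫ τ in Set.Ici t, U (-(s * τ) + α - β)) →
        (∀ t ∈ Set.Icc (0:ℝ) T, pdx ψ 0 t = -U (-(s * t) + α - β)) →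
        (∀ t ∈ Set.Icc (0:ℝ) T,
          pdx (pdx φ) 0 t = (s ^ 2)⁻¹ * (s * deriv U (-(s * t) + α - β))) →
        (∀ t ∈ Set.Icc (0:ℝ) T, Real.sqrt (Hsq 3 φ t) + Real.sqrt (Hsq 2 ψ t) ≤ ε) →
        vp - vm ≤ δ₀ → ε ≤ ε₀ →
        ∀ t ∈ Set.Icc (0:ℝ) T,
          |∫ τ in (0:ℝ)..t, φ 0 τ * ψ 0 τ| +
          |∫ τ in (0:ℝ)..t, ψ 0 τ * pdx ψ 0 τ| +
          |∫ τ in (0:ℝ)..t, pdx ψ 0 τ * pdx φ 0 τ| +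
          |∫ τ in (0:ℝ)..t, pdt ψ 0 τ * pdx ψ 0 τ| +
          |∫ τ in (0:ℝ)..t, pdx ψ 0 τ * pdx (pdx ψ) 0 τ| +
          |∫ τ in (0:ℝ)..t, pdt (pdx ψ) 0 τ * pdx (pdx ψ) 0 τ|
            ≤ C * Real.exp (-(c₁ * β)) := by
  set D := vp - vm with hD
  have hD0 : 0 < D := sub_pos.2 hvmvp
  set a := c₁ * s with ha_def
  have ha : 0 < a := mul_pos hc₁ hs
  set K₀ := C₁ * (D / a + D + s * D ^ 2 + s ^ 2 * D ^ 2) * Real.exp c₁ with hK₀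
  have hK₀pos : 0 < K₀ := by positivity
  refine ⟨D, hD0, 1, one_pos, 6 * (K₀ / a + K₀), by positivity, ?_⟩
  intro up α β T ε V U φ ψ _ hα hβ _ _ hε1 _ hU _ _ _ _ hdec _ hdec1 hdec2 _ hφ hψ hφi hψi _ hcont _
    hφ0 hψ0 _ hN _ _ t ht
  set E := Real.exp c₁ * Real.exp (-(c₁ * β)) with hE
  have hE0 : 0 < E := by positivity
  set K := K₀ * Real.exp (-(c₁ * β)) with hK
  have hK0 : 0 ≤ K := by positivity
  have hKE : K = C₁ * (D / a * E) + C₁ * D * E + s * (C₁ * D ^ 2 * E)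
      + s ^ 2 * (C₁ * D ^ 2 * E) := by
    rw [hK, hK₀, hE]; ring
  have hpart1 : 0 ≤ C₁ * (D / a * E) := by positivity
  have hpart2 : 0 ≤ C₁ * D * E := by positivity
  have hpart3 : 0 ≤ s * (C₁ * D ^ 2 * E) := by positivity
  have hpart4 : 0 ≤ s ^ 2 * (C₁ * D ^ 2 * E) := by positivity
  have hUb : ∀ τ ≥ 0, |U (-(s * τ) + α - β)| ≤ C₁ * D * E * Real.exp (-(a * τ)) := by
    intro τ hτ
    obtain ⟨hneg, hexp⟩ := exp_neg_abs_shift_le (c := c₁) hs hc₁ hα hβ hτ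
    rw [abs_of_nonpos hneg, mul_neg, neg_neg] at hexp
    calc _ ≤ C₁ * D * Real.exp (c₁ * (-(s * τ) + α - β)) :=
          (le_add_of_nonneg_left (abs_nonneg _)).trans (hdec _ hneg)
      _ ≤ C₁ * D * (E * Real.exp (-(a * τ))) := by gcongr
      _ = _ := by ring
  have hdecay : ∀ g h : ℝ → ℝ,
      (∀ ξ, |g ξ| + |h ξ| ≤ C₁ * D ^ 2 * Real.exp (-(c₁ * |ξ|))) → ∀ τ ≥ 0,
      |h (-(s * τ) + α - β)| ≤ C₁ * D ^ 2 * E * Real.exp (-(a * τ)) := by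
    intro g h hgh τ hτ
    calc _ ≤ _ := (le_add_of_nonneg_left (abs_nonneg _)).trans (hgh _)
      _ ≤ C₁ * D ^ 2 * (E * Real.exp (-(a * τ))) := by
          gcongr
          exact (exp_neg_abs_shift_le hs hc₁ hα hβ hτ).2
      _ = _ := by ring
  have hAb : ∀ τ ≥ 0, |∫ r in Set.Ici τ, U (-(s * r) + α - β)| ≤ K * Real.exp (-(a * τ)) := by
    intro τ hτ
    refine (abs_integral_Ici_le_of_exp_bound ha fun r hr => hUb r (hτ.trans hr)).trans ?_
    gcongr
    calc C₁ * D * E / a = C₁ * (D / a * E) := by ring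
      _ ≤ K := by linarith
  have hwb : ∀ τ ≥ 0, |-U (-(s * τ) + α - β)| ≤ K * Real.exp (-(a * τ)) := by
    intro τ hτ
    rw [abs_neg]
    refine (hUb τ hτ).trans ?_
    gcongr
    linarith
  have hwb' : ∀ τ ≥ 0, |s * deriv U (-(s * τ) + α - β)| ≤ K * Real.exp (-(a * τ)) := by
    intro τ hτ
    rw [abs_mul, abs_of_pos hs]
    calc _ ≤ s * (C₁ * D ^ 2 * E * Real.exp (-(a * τ))) := by
          gcongr
          exact hdecay _ _ hdec1 τ hτ
      _ = s * (C₁ * D ^ 2 * E) * Real.exp (-(a * τ)) := by ring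
      _ ≤ _ := by
          gcongr
          linarith
  have hwb'' : ∀ τ ≥ 0, |-(s ^ 2 * deriv (deriv U) (-(s * τ) + α - β))|
      ≤ K * Real.exp (-(a * τ)) := by
    intro τ hτ
    rw [abs_neg, abs_mul, abs_of_pos (pow_pos hs 2)]
    calc _ ≤ s ^ 2 * (C₁ * D ^ 2 * E * Real.exp (-(a * τ))) := by
          gcongr
          exact hdecay _ _ hdec2 τ hτ
      _ = s ^ 2 * (C₁ * D ^ 2 * E) * Real.exp (-(a * τ)) := by ring
      _ ≤ _ := by
          gcongr
          linarith
  have hU1 : ContDiff ℝ (⊤ : ℕ∞) (deriv U) := (contDiff_infty_iff_deriv.1 hU).2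
  have hU2 : ContDiff ℝ (⊤ : ℕ∞) (deriv (deriv U)) := (contDiff_infty_iff_deriv.1 hU1).2
  have hshift : ∀ τ, HasDerivAt (fun r : ℝ => -(s * r) + α - β) (-s) τ := fun τ => by
    simpa using ((((hasDerivAt_id τ).const_mul s).neg).add_const α).sub_const β
  have hw : ∀ τ, HasDerivAt (fun r => -U (-(s * r) + α - β))
      (s * deriv U (-(s * τ) + α - β)) τ := fun τ => by
    have h := ((hU.differentiable (by simp)).differentiableAt.hasDerivAt.comp τ (hshift τ)).neg
    exact h.congr_deriv (by ring)
  have hw1 : ∀ τ, HasDerivAt (fun r => s * deriv U (-(s * r) + α - β))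
      (-(s ^ 2 * deriv (deriv U) (-(s * τ) + α - β))) τ := fun τ => by
    have h := ((hU1.differentiable (by simp)).differentiableAt.hasDerivAt.comp τ
      (hshift τ)).const_mul s
    exact h.congr_deriv (by ring)
  have hcw1 : Continuous (fun r => s * deriv U (-(s * r) + α - β)) :=
    continuous_iff_continuousAt.2 fun τ => (hw1 τ).continuousAt
  have hcw2 : Continuous (fun r => -(s ^ 2 * deriv (deriv U) (-(s * r) + α - β))) := by
    have := hU2.continuous
    fun_prop
  have hsub : Set.Icc 0 t ⊆ Set.Icc 0 T := Set.Icc_subset_Icc_right ht.2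
  have hψb : ∀ τ ∈ Set.Icc 0 t, |ψ 0 τ| ≤ 1 := fun τ hτ =>
    (abs_iterate_pdx_le_of_sqrt_Hsq_le (j := 0) (k := 2) (by norm_num) hψ
      (hψi τ (hsub hτ) 0 (by norm_num)).1 (hψi τ (hsub hτ) 1 (by norm_num)).1
      (hψi τ (hsub hτ) 0 (by norm_num)).2
      ((le_add_of_nonneg_left (Real.sqrt_nonneg _)).trans (hN τ (hsub hτ)))).trans hε1.le
  have hφb : ∀ τ ∈ Set.Icc 0 t, |pdx φ 0 τ| ≤ 1 := fun τ hτ =>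
    (abs_iterate_pdx_le_of_sqrt_Hsq_le (j := 1) (k := 3) (by norm_num) (contDiff_pdx hφ)
      (hφi τ (hsub hτ) 1 (by norm_num)).1 (hφi τ (hsub hτ) 2 (by norm_num)).1
      (hφi τ (hsub hτ) 1 (by norm_num)).2
      ((le_add_of_nonneg_right (Real.sqrt_nonneg _)).trans (hN τ (hsub hτ)))).trans hε1.le
  have hsubo : Set.Ioo 0 t ⊆ Set.Ioo 0 T := Set.Ioo_subset_Ioo_right ht.2
  have hxx : ∀ τ ∈ Set.Ioo 0 t, pdx (pdx ψ) 0 τ = pdt (pdx φ) 0 τ := fun τ hτ =>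
    pdx_pdx_eq_pdt_pdx_at_zero hφ hψ fun x hx => hcont x hx τ (hsubo hτ)
  have hxt : ∀ τ ∈ Set.Ioo 0 t, pdt (pdx ψ) 0 τ = s * deriv U (-(s * τ) + α - β) := by
    intro τ hτ
    rw [← (hw τ).deriv]
    refine Filter.EventuallyEq.deriv_eq ?_
    filter_upwards [Ioo_mem_nhds hτ.1 hτ.2] with r hr
    exact hψ0 r (hsub (Set.Ioo_subset_Icc_self hr))
  have hψt := hasDerivAt_time hψ 0
  have hψt' := continuous_time (contDiff_pdt hψ) 0
  have hφt := hasDerivAt_time (contDiff_pdx hφ) 0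
  have hφt' := continuous_time (contDiff_pdt (contDiff_pdx hφ)) 0
  have h1 : |∫ τ in (0:ℝ)..t, φ 0 τ * ψ 0 τ| ≤ K / a :=
    abs_integral_mul_le_of_exp_bound ha hK0 ht.1 hψb hAb fun τ hτ => by rw [hφ0 τ (hsub hτ)]
  have h2 : |∫ τ in (0:ℝ)..t, ψ 0 τ * pdx ψ 0 τ| ≤ K / a :=
    abs_integral_mul_le_of_exp_bound ha hK0 ht.1 hψb hwb fun τ hτ => by
      rw [hψ0 τ (hsub hτ), mul_comm]
  have h3 : |∫ τ in (0:ℝ)..t, pdx ψ 0 τ * pdx φ 0 τ| ≤ K / a :=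
    abs_integral_mul_le_of_exp_bound ha hK0 ht.1 hφb hwb fun τ hτ => by rw [hψ0 τ (hsub hτ)]
  have h4 : |∫ τ in (0:ℝ)..t, pdt ψ 0 τ * pdx ψ 0 τ| ≤ 2 * K + K / a :=
    abs_integral_mul_deriv_le_of_exp_bound ha hK0 ht.1 hψt hψt' hw hcw1 hψb hwb hwb'
      fun τ hτ => by rw [hψ0 τ (hsub (Set.Ioo_subset_Icc_self hτ)), mul_comm]
  have h5 : |∫ τ in (0:ℝ)..t, pdx ψ 0 τ * pdx (pdx ψ) 0 τ| ≤ 2 * K + K / a :=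
    abs_integral_mul_deriv_le_of_exp_bound ha hK0 ht.1 hφt hφt' hw hcw1 hφb hwb hwb'
      fun τ hτ => by rw [hψ0 τ (hsub (Set.Ioo_subset_Icc_self hτ)), hxx τ hτ]
  have h6 : |∫ τ in (0:ℝ)..t, pdt (pdx ψ) 0 τ * pdx (pdx ψ) 0 τ| ≤ 2 * K + K / a :=
    abs_integral_mul_deriv_le_of_exp_bound ha hK0 ht.1 hφt hφt' hw1 hcw2 hφb hwb' hwb''
      fun τ hτ => by rw [hxt τ hτ, hxx τ hτ]
  have hsum : 6 * (K₀ / a + K₀) * Real.exp (-(c₁ * β)) = 6 * (K / a) + 6 * K := by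
    rw [hK]; ring
  rw [hsum]
  linarith
end
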